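/- Let A = (a_{i,j}) ∈ Z^{t×(t+c-1)} be a degree matrix with c ≥ 2 and a_{2,1} < 0, and let h^A = (h_0,...,h_s). Then there exists an index i_0 (any i_0 with a_{1,1} ≤ i_0 ≤ a_{1,1} - a_{2,1} - 1 works) such that h_{i_0} > h_{s-i_0}. In particular h^A is not flawless, hence not a pure O-sequence. -/

import Mathlib

open Polynomial

/-- The polynomial `1 + z + ⋯ + z^(d-1)`. -/
noncomputable def geom (d : ℤ) : Polynomial ℤ :=
  ∑ i ∈ Finset.range d.toNat, Polynomial.X ^ i

/-- The h-polynomial of a standard determinantal ideal with `t × m` degree matrix `A`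
(codimension `m - t + 1`), defined via the basic-double-link recursion applied at the
bottom-right entry, with the conventions `hp = 0` for `t = 0` and `hp = 1` for `m < t`. -/
noncomputable def hp : (t m : ℕ) → Matrix (Fin t) (Fin m) ℤ → Polynomial ℤ
  | 0, _, _ => 0
  | _ + 1, 0, _ => 1
  | t + 1, m + 1, A =>
    if m + 1 ≤ t then 1
    else
      Polynomial.X ^ (A (Fin.last t) (Fin.last m)).toNat *
          hp t m (fun i j => A i.castSucc j.castSucc) +
        geom (A (Fin.last t) (Fin.last m)) * hp (t + 1) m (fun i j => A i j.castSucc)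
  termination_by t m => (t, m)

/-- Delete row `k` and column `l` of a matrix. -/
def delRC {t m : ℕ} (A : Matrix (Fin (t + 1)) (Fin (m + 1)) ℤ)
    (k : Fin (t + 1)) (l : Fin (m + 1)) : Matrix (Fin t) (Fin m) ℤ :=
  fun i j => A (k.succAbove i) (l.succAbove j)

/-- Delete column `l` of a matrix. -/
def delC {t m : ℕ} (A : Matrix (Fin t) (Fin (m + 1)) ℤ) (l : Fin (m + 1)) :
    Matrix (Fin t) (Fin m) ℤ :=
  fun i j => A i (l.succAbove j)

/-- `A` is a degree matrix: homogeneous (`a_{i,j} = b_j - a_i`), entries weakly increasing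
left-to-right and bottom-to-top, and positive on the main diagonal. -/
def IsDegreeMatrix {a b : ℕ} (A : Matrix (Fin a) (Fin b) ℤ) : Prop :=
  (∃ (α : Fin a → ℤ) (β : Fin b → ℤ), ∀ i j, A i j = β j - α i) ∧
    (∀ (i : Fin a) (j j' : Fin b), j ≤ j' → A i j ≤ A i j') ∧
    (∀ (i i' : Fin a) (j : Fin b), i ≤ i' → A i' j ≤ A i j) ∧
    (∀ (i : Fin a) (h : (i : ℕ) < b), 0 < A i ⟨i, h⟩)

/-- Binomial coefficient with integer top argument, with the convention that it vanishes
whenever the top argument is negative or smaller than the bottom one. -/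
def ch (a : ℤ) (b : ℕ) : ℤ := if a < 0 then 0 else (a.toNat).choose b

/-- `h : ℕ → ℤ` is a pure O-sequence: it is the f-vector (counting monomials by degree)
of a nonempty finite order ideal of monomials all of whose maximal elements have the
same degree. -/
def IsPureOSequence (h : ℕ → ℤ) : Prop :=
  ∃ (N : ℕ) (Γ : Finset (Fin N → ℕ)),
    Γ.Nonempty ∧
      (∀ μ ∈ Γ, ∀ ν : Fin N → ℕ, ν ≤ μ → ν ∈ Γ) ∧
      (∃ d : ℕ, ∀ μ ∈ Γ, (∀ ν ∈ Γ, μ ≤ ν → μ = ν) → ∑ j, μ j = d) ∧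
      (∀ i : ℕ, ((Γ.filter fun μ => ∑ j, μ j = i).card : ℤ) = h i)


/-- The h-polynomial attached to a homogeneous matrix with entries `b j - a i`. -/
noncomputable def HH (a b : ℕ → ℤ) (t m : ℕ) : Polynomial ℤ :=
  hp t m (fun i j => b j - a i)

lemma HH_zero (a b : ℕ → ℤ) (m : ℕ) : HH a b 0 m = 0 := by
  exact hp.eq_1 _ _

lemma HH_low (a b : ℕ → ℤ) (t m : ℕ) (h : m < t) : HH a b t m = 1 := by
  unfold HH
  obtain _ | t := t
  · omega
  obtain _ | m := m
  · exact hp.eq_2 _ _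
  · exact (hp.eq_3 _ _ _).trans (if_pos (by omega))

lemma HH_rec (a b : ℕ → ℤ) (t m : ℕ) (h : t ≤ m) : HH a b (t + 1) (m + 1) =
    X ^ (b m - a t).toNat * HH a b t m + geom (b m - a t) * HH a b (t + 1) m := by
  unfold HH
  refine (hp.eq_3 _ _ _).trans ((if_neg (by omega)).trans ?_)
  simp

lemma geom_mul (d : ℤ) : (1 - X) * geom d = 1 - X ^ d.toNat := by
  unfold geom
  exact mul_neg_geom_sum _ _

lemma geom_coeff (d : ℤ) (n : ℕ) : (geom d).coeff n = if n < d.toNat then 1 else 0 := by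
  unfold geom
  simp [Polynomial.finsetSum_coeff, Polynomial.coeff_X_pow]

lemma geom_natDegree (d : ℤ) (hd : 0 < d) : (geom d).natDegree = d.toNat - 1 := by
  apply Polynomial.natDegree_eq_of_le_of_coeff_ne_zero
  · rw [Polynomial.natDegree_le_iff_coeff_eq_zero]
    intro n hn
    rw [geom_coeff, if_neg (by omega)]
  · rw [geom_coeff, if_pos (by omega)]; norm_num

lemma geom_monic (d : ℤ) (hd : 0 < d) : (geom d).Monic := by
  rw [Polynomial.Monic, Polynomial.leadingCoeff, geom_natDegree d hd, geom_coeff, if_pos (by omega)]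

lemma geom_reverse (d : ℤ) (hd : 0 < d) : (geom d).reverse = geom d := by
  ext n
  rw [Polynomial.coeff_reverse, geom_coeff, geom_coeff, geom_natDegree d hd]
  by_cases h : n ≤ d.toNat - 1
  · rw [Polynomial.revAt_le h, if_pos (by omega), if_pos (by omega)]
  · rw [Polynomial.revAt_eq_self_of_lt (by omega)]

lemma HH_low_coeff (a b : ℕ → ℤ) (hb : Monotone b) (m : ℕ) :
    ∀ t, t ≤ m + 1 → (X : Polynomial ℤ) ^ (∑ k ∈ Finset.range t, (b k - a k).toNat) ∣
      (1 - X) ^ (m + 1 - t) * HH a b t m - 1 := by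
  induction m with
  | zero =>
    intro t ht
    obtain _ | t := t
    · simp
    · obtain rfl : t = 0 := by omega
      rw [HH_low _ _ _ _ (by omega)]; simp
  | succ m ih =>
    intro t ht
    obtain _ | t := t
    · simp
    rcases Nat.lt_or_ge m t with h | h
    · rw [HH_low _ _ _ _ (by omega)]
      obtain rfl : t = m + 1 := by omega
      simp
    obtain ⟨k, rfl⟩ := Nat.exists_eq_add_of_le h
    rw [HH_rec _ _ _ _ h]
    have h1 := ih t (by omega)
    have h2 := ih (t + 1) (by omega)
    rw [show t + k + 1 - t = k + 1 by omega] at h1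
    rw [show t + k + 1 - (t + 1) = k by omega] at h2
    rw [show t + k + 1 + 1 - (t + 1) = k + 1 by omega]
    have key : (1 - X) ^ (k + 1) * (X ^ (b (t + k) - a t).toNat * HH a b t (t + k) +
        geom (b (t + k) - a t) * HH a b (t + 1) (t + k)) - 1 =
        X ^ (b (t + k) - a t).toNat * ((1 - X) ^ (k + 1) * HH a b t (t + k) - 1) +
        (1 - X ^ (b (t + k) - a t).toNat) * ((1 - X) ^ k * HH a b (t + 1) (t + k) - 1) := by
      rw [← geom_mul]
      have := geom_mul (b (t + k) - a t)
      rw [pow_succ]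
      linear_combination this
    rw [key]
    apply dvd_add
    · rw [Finset.sum_range_succ, pow_add, mul_comm]
      apply mul_dvd_mul _ h1
      apply pow_dvd_pow
      have := hb (show t ≤ t + k by omega)
      omega
    · exact Dvd.dvd.mul_left h2 _

/-- The top degree. -/
def ss (a b : ℕ → ℤ) (t m : ℕ) : ℤ :=
  ∑ j ∈ Finset.range m, b j - ∑ k ∈ Finset.range t, a k - ((m : ℤ) - t) * a 0 - ((m : ℤ) - t + 1)

lemma ss_succ (a b : ℕ → ℤ) (t m : ℕ) : ss a b (t + 1) (m + 1) = ss a b t m + (b m - a t) := by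
  unfold ss
  rw [Finset.sum_range_succ, Finset.sum_range_succ]
  push_cast; ring

lemma ss_succ_right (a b : ℕ → ℤ) (t m : ℕ) :
    ss a b t (m + 1) = ss a b t m + (b m - a 0 - 1) := by
  unfold ss
  rw [Finset.sum_range_succ]
  push_cast; ring

lemma HH_natDegree_le (a b : ℕ → ℤ) (ha : Monotone a) (hb : Monotone b) (hab : ∀ i, a i < b i)
    (m : ℕ) : ∀ t, 1 ≤ t → t ≤ m → ((HH a b t m).natDegree : ℤ) ≤ ss a b t m := by
  induction m with
  | zero => intro t h1 h2; omega
  | succ m ih =>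
    intro t h1 h2
    obtain ⟨t, rfl⟩ : ∃ t', t = t' + 1 := ⟨t - 1, by omega⟩
    have htm : t ≤ m := by omega
    have hd : 0 < b m - a t := by have := hab t; have := hb htm; omega
    have ha0 : a 0 ≤ a t := ha (by omega)
    rw [HH_rec _ _ _ _ htm]
    have hadd := Polynomial.natDegree_add_le (X ^ (b m - a t).toNat * HH a b t m)
      (geom (b m - a t) * HH a b (t + 1) m)
    have hs1 := ss_succ a b t m
    have hs2 := ss_succ_right a b (t + 1) m
    have hg := geom_natDegree _ hd
    have hm2 := Polynomial.natDegree_mul_le (p := geom (b m - a t)) (q := HH a b (t + 1) m)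
    have B2 : ((geom (b m - a t) * HH a b (t + 1) m).natDegree : ℤ) ≤ ss a b (t + 1) (m + 1) := by
      rcases Nat.lt_or_ge t m with h | h
      · have := ih (t + 1) (by omega) (by omega)
        omega
      · obtain rfl : t = m := by omega
        rw [HH_low a b (t + 1) t (by omega)] at hm2 ⊢
        have h0 : 0 ≤ ss a b t t + 1 := by
          rcases Nat.eq_zero_or_pos t with h | h
          · subst h; simp [ss]
          · have := ih t h le_rfl
            omega
        simp only [Polynomial.natDegree_one] at hm2
        omega
    have B1 : ((X ^ (b m - a t).toNat * HH a b t m).natDegree : ℤ) ≤ ss a b (t + 1) (m + 1) := by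
      rcases Nat.eq_zero_or_pos t with h | h
      · subst h
        rw [HH_zero]
        simp only [mul_zero, Polynomial.natDegree_zero]
        omega
      · have := ih t h htm
        have hm1 := Polynomial.natDegree_mul_le (p := X ^ (b m - a t).toNat) (q := HH a b t m)
        rw [Polynomial.natDegree_X_pow] at hm1
        omega
    omega

/-- The h-polynomial of the first row. -/
noncomputable def PP (a b : ℕ → ℤ) (c : ℕ) : Polynomial ℤ :=
  ∏ j ∈ Finset.range c, geom (b j - a 0)

lemma HH_one (a b : ℕ → ℤ) (m : ℕ) : HH a b 1 m = PP a b m := by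
  induction m with
  | zero => rw [HH_low _ _ _ _ (by omega)]; simp [PP]
  | succ m ih =>
    rw [HH_rec _ _ _ _ (by omega), HH_zero, ih]
    unfold PP
    rw [Finset.prod_range_succ]; ring

lemma HH_top (a b : ℕ → ℤ) (ha : Monotone a) (hb : Monotone b) (hab : ∀ i, a i < b i)
    (h21 : b 0 < a 1) (c t : ℕ) :
    ∃ D : ℕ, (D : ℤ) + ss a b 1 (c + 2) = ss a b (t + 1) (t + c + 2) ∧
      ∀ n : ℕ, ss a b (t + 1) (t + c + 2) - (b 0 - a 0) ≤ n →
        (HH a b (t + 1) (t + c + 2)).coeff n = (X ^ D * PP a b (c + 2)).coeff n := by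
  induction t with
  | zero =>
    refine ⟨0, by simp, fun n _ => ?_⟩
    simp [HH_one]
  | succ t ih =>
    obtain ⟨D, hD, ih⟩ := ih
    have e : t + 1 + c + 2 = (t + c + 2) + 1 := by omega
    rw [e]
    have hd : 0 < b (t + c + 2) - a (t + 1) := by
      have := hab (t + 1)
      have := hb (show t + 1 ≤ t + c + 2 by omega); omega
    have hs1 := ss_succ a b (t + 1) (t + c + 2)
    have hs2 := ss_succ_right a b (t + 2) (t + c + 2)
    refine ⟨D + (b (t + c + 2) - a (t + 1)).toNat, ?_, ?_⟩
    · push_cast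
      omega
    · intro n hn
      rw [HH_rec _ _ _ _ (by omega), Polynomial.coeff_add]
      have hz : (geom (b (t + c + 2) - a (t + 1)) * HH a b (t + 1 + 1) (t + c + 2)).coeff n = 0 := by
        apply Polynomial.coeff_eq_zero_of_natDegree_lt
        have h1 := Polynomial.natDegree_mul_le (p := geom (b (t + c + 2) - a (t + 1)))
          (q := HH a b (t + 1 + 1) (t + c + 2))
        have h2 := geom_natDegree _ hd
        have h3 := HH_natDegree_le a b ha hb hab (t + c + 2) (t + 1 + 1) (by omega) (by omega)
        have h4 : a 1 ≤ a (t + 1) := ha (by omega)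
        change ss a b (t + 1 + 1) _ = ss a b (t + 1 + 1) _ + _ at hs2
        omega
      rw [hz, add_zero, pow_add, mul_comm (X ^ D), mul_assoc, Polynomial.coeff_X_pow_mul',
        Polynomial.coeff_X_pow_mul']
      split_ifs with hle
      · apply ih
        omega
      · rfl

lemma PP_monic (a b : ℕ → ℤ) (hab : ∀ i, a 0 < b i) (c : ℕ) : (PP a b c).Monic := by
  unfold PP
  apply Polynomial.monic_prod_of_monic
  intro i _
  exact geom_monic _ (by have := hab i; omega)

lemma PP_natDegree (a b : ℕ → ℤ) (hab : ∀ i, a 0 < b i) (c : ℕ) :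
    ((PP a b c).natDegree : ℤ) = ss a b 1 c := by
  induction c with
  | zero => simp [PP, ss]
  | succ c ih =>
    rw [ss_succ_right, ← ih]
    have : PP a b (c + 1) = PP a b c * geom (b c - a 0) := by
      unfold PP; rw [Finset.prod_range_succ]
    have hc := hab c
    rw [this, (PP_monic a b hab c).natDegree_mul (geom_monic _ (by omega)),
      geom_natDegree _ (by omega)]
    push_cast
    omega

lemma PP_reverse (a b : ℕ → ℤ) (hab : ∀ i, a 0 < b i) (c : ℕ) :
    (PP a b c).reverse = PP a b c := by
  induction c with
  | zero =>
    simp only [PP, Finset.range_zero, Finset.prod_empty]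
    exact Polynomial.reverse_C 1
  | succ c ih =>
    have : PP a b (c + 1) = PP a b c * geom (b c - a 0) := by
      unfold PP; rw [Finset.prod_range_succ]
    have hc := hab c
    rw [this, Polynomial.reverse_mul_of_domain, ih, geom_reverse _ (by omega)]

lemma PP_low (a b : ℕ → ℤ) (p : ℕ) (hp0 : (b 0 - a 0).toNat = p)
    (h1 : ∀ i, 1 ≤ i → p + 1 ≤ (b i - a 0).toNat) (c : ℕ) :
    (X : Polynomial ℤ) ^ (p + 1) ∣ (1 - X) ^ (c + 1) * PP a b (c + 1) - (1 - X ^ p) := by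
  induction c with
  | zero => simp [PP, geom_mul, hp0]
  | succ c ih =>
    have : PP a b (c + 1 + 1) = PP a b (c + 1) * geom (b (c + 1) - a 0) := by
      unfold PP; rw [Finset.prod_range_succ]
    rw [this]
    have hg := geom_mul (b (c + 1) - a 0)
    have key : (1 - X) ^ (c + 1 + 1) * (PP a b (c + 1) * geom (b (c + 1) - a 0)) - (1 - X ^ p) =
      ((1 - X) ^ (c + 1) * PP a b (c + 1) - (1 - X ^ p)) -
        X ^ (b (c + 1) - a 0).toNat * ((1 - X) ^ (c + 1) * PP a b (c + 1)) := by
      rw [pow_succ (1 - X) (c + 1)]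
      linear_combination ((1 - X) ^ (c + 1) * PP a b (c + 1)) * hg
    rw [key]
    apply dvd_sub ih
    exact Dvd.dvd.mul_right (pow_dvd_pow _ (h1 _ (by omega))) _

lemma main_poly (a b : ℕ → ℤ) (ha : Monotone a) (hb : Monotone b) (hab : ∀ i, a i < b i)
    (h21 : b 0 < a 1) (t c : ℕ) :
    2 * (b 0 - a 0).toNat ≤ (HH a b (t + 2) (t + c + 3)).natDegree ∧
    (HH a b (t + 2) (t + c + 3)).coeff
        ((HH a b (t + 2) (t + c + 3)).natDegree - (b 0 - a 0).toNat) <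
      (HH a b (t + 2) (t + c + 3)).coeff (b 0 - a 0).toNat := by
  have hab0 : ∀ i, a 0 < b i := fun i => lt_of_le_of_lt (ha (Nat.zero_le i)) (hab i)
  obtain ⟨p, hp0⟩ : ∃ p, (b 0 - a 0).toNat = p := ⟨_, rfl⟩
  obtain ⟨D, hD, htop⟩ := HH_top a b ha hb hab h21 c (t + 1)
  have hdeg := HH_natDegree_le a b ha hb hab (t + 1 + c + 2) (t + 1 + 1) (by omega) (by omega)
  have hlow := HH_low_coeff a b hb (t + 1 + c + 2) (t + 1 + 1) (by omega)
  rw [show t + 1 + c + 2 = t + c + 3 by omega] at *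
  change ∀ n : ℕ, _ → (HH a b (t + 2) (t + c + 3)).coeff n = _ at htop
  change ((HH a b (t + 2) (t + c + 3)).natDegree : ℤ) ≤ _ at hdeg
  rw [show t + c + 3 + 1 - (t + 1 + 1) = c + 2 by omega] at hlow
  change _ ∣ _ * HH a b (t + 2) (t + c + 3) - 1 at hlow
  rw [hp0]
  set H := HH a b (t + 2) (t + c + 3) with hH
  have hPd := PP_natDegree a b hab0 (c + 2)
  have hPr := PP_reverse a b hab0 (c + 2)
  have hPm := PP_monic a b hab0 (c + 2)
  have h1 : ∀ i, 1 ≤ i → p + 1 ≤ (b i - a 0).toNat := by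
    intro i hi
    have := hb hi
    have := hab 1
    have := hab0 0
    omega
  have hPl := PP_low a b p hp0 h1 (c + 1)
  set P := PP a b (c + 2) with hP
  have hs2p : ∀ c, 2 * (p : ℤ) ≤ ss a b 1 (c + 2) := by
    intro c
    induction c with
    | zero =>
      rw [ss_succ_right, ss_succ_right]
      have := hab0 0
      have := hab 1
      have : ss a b 1 0 = 0 := by simp [ss]
      omega
    | succ c ih =>
      rw [ss_succ_right]
      have := hab0 (c + 2)
      omega
  have hs2 := hs2p c
  have hb0 := hab0 0
  have hnd : H.natDegree = D + P.natDegree := by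
    apply Polynomial.natDegree_eq_of_le_of_coeff_ne_zero
    · omega
    · rw [htop _ (by push_cast; omega), Polynomial.coeff_X_pow_mul', if_pos (by omega)]
      rw [show D + P.natDegree - D = P.natDegree by omega]
      rw [show P.coeff P.natDegree = 1 from hPm]
      norm_num
  refine ⟨by omega, ?_⟩
  have hc1 : H.coeff (H.natDegree - p) = P.coeff p := by
    rw [htop _ (by omega), Polynomial.coeff_X_pow_mul', if_pos (by omega)]
    conv_rhs => rw [← hPr, Polynomial.coeff_reverse, Polynomial.revAt_le (by omega)]
    congr 1
    omega
  have hN : (X : Polynomial ℤ) ^ (p + 1) ∣ (1 - X) ^ (c + 2) * H - 1 := by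
    refine dvd_trans (pow_dvd_pow _ ?_) hlow
    rw [Finset.sum_range_succ', Finset.sum_range_succ', hp0]
    have := hab 1
    simp only [zero_add]
    omega
  have hX : (X : Polynomial ℤ) ∣ (1 - X) ^ (c + 2) - 1 := by
    have := sub_dvd_pow_sub_pow (1 - X : Polynomial ℤ) 1 (c + 2)
    rw [one_pow] at this
    refine dvd_trans ⟨-1, by ring⟩ this
  have h3 : (X : Polynomial ℤ) ^ (p + 1) ∣ (1 - X) ^ (c + 2) * (H - P - X ^ p) := by
    have e : (1 - X) ^ (c + 2) * (H - P - X ^ p) = ((1 - X) ^ (c + 2) * H - 1) -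
      ((1 - X) ^ (c + 1 + 1) * P - (1 - X ^ p)) - X ^ p * ((1 - X) ^ (c + 2) - 1) := by ring
    rw [e]
    refine dvd_sub (dvd_sub hN hPl) ?_
    rw [pow_succ]
    exact mul_dvd_mul_left _ hX
  have hcop : IsCoprime ((X : Polynomial ℤ) ^ (p + 1)) ((1 - X) ^ (c + 2)) := by
    apply IsCoprime.pow
    exact ⟨1, 1, by ring⟩
  have h4 := hcop.dvd_of_dvd_mul_left h3
  rw [Polynomial.X_pow_dvd_iff] at h4
  have h5 := h4 p (by omega)
  simp only [Polynomial.coeff_sub, Polynomial.coeff_X_pow, if_true] at h5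
  rw [hc1]
  omega

/-- Raising operator on functions on monomials. -/
def LL {N : ℕ} (f : (Fin N → ℕ) → ℚ) : (Fin N → ℕ) → ℚ :=
  fun y => ∑ j, (y j : ℚ) * f (y - Pi.single j 1)

/-- Lowering operator on functions on monomials, relative to `u`. -/
def MM {N : ℕ} (u : Fin N → ℕ) (f : (Fin N → ℕ) → ℚ) : (Fin N → ℕ) → ℚ :=
  fun y => ∑ j, ((u j : ℚ) - y j) * f (y + Pi.single j 1)

lemma LL_add {N : ℕ} (f g : (Fin N → ℕ) → ℚ) : LL (f + g) = LL f + LL g := by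
  funext y
  simp [LL, mul_add, Finset.sum_add_distrib]

lemma LL_smul {N : ℕ} (r : ℚ) (f : (Fin N → ℕ) → ℚ) : LL (r • f) = r • LL f := by
  funext y
  simp only [LL, Pi.smul_apply, smul_eq_mul, Finset.mul_sum]
  exact Finset.sum_congr rfl fun _ _ => by ring

lemma LLi_add {N : ℕ} (m : ℕ) (f g : (Fin N → ℕ) → ℚ) :
    LL^[m] (f + g) = LL^[m] f + LL^[m] g := by
  induction m with
  | zero => rfl
  | succ m ih => simp only [Function.iterate_succ_apply', ih, LL_add]

lemma LLi_smul {N : ℕ} (m : ℕ) (r : ℚ) (f : (Fin N → ℕ) → ℚ) :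
    LL^[m] (r • f) = r • LL^[m] f := by
  induction m with
  | zero => rfl
  | succ m ih => simp only [Function.iterate_succ_apply', ih, LL_smul]

/-- `f` is supported in degree `k`. -/
def Lev {N : ℕ} (k : ℤ) (f : (Fin N → ℕ) → ℚ) : Prop :=
  ∀ y, f y ≠ 0 → ((∑ j, y j : ℕ) : ℤ) = k

/-- `f` vanishes on the divisors of `u`. -/
def Zu {N : ℕ} (u : Fin N → ℕ) (f : (Fin N → ℕ) → ℚ) : Prop :=
  ∀ y, y ≤ u → f y = 0

lemma Zu.LL {N : ℕ} {u : Fin N → ℕ} {f : (Fin N → ℕ) → ℚ} (h : Zu u f) : Zu u (LL f) := by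
  intro y hy
  apply Finset.sum_eq_zero
  intro j _
  rw [h _ (tsub_le_self.trans hy), mul_zero]

lemma Zu.LLi {N : ℕ} {u : Fin N → ℕ} {f : (Fin N → ℕ) → ℚ} (h : Zu u f) (m : ℕ) :
    Zu u (_root_.LL^[m] f) := by
  induction m with
  | zero => exact h
  | succ m ih => rw [Function.iterate_succ_apply']; exact ih.LL

lemma Zu.MM {N : ℕ} {u : Fin N → ℕ} {f : (Fin N → ℕ) → ℚ} (h : Zu u f) : Zu u (MM u f) := by
  intro y hy
  apply Finset.sum_eq_zero
  intro j _
  by_cases hj : y j = u j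
  · rw [hj, sub_self, zero_mul]
  · rw [h, mul_zero]
    intro k
    have hk : y k ≤ u k := hy k
    have hj' : y j ≤ u j := hy j
    by_cases e : k = j
    · subst e
      simp only [Pi.add_apply, Pi.single_eq_same]
      omega
    · simp only [Pi.add_apply, Pi.single_eq_of_ne e]
      omega

lemma sum_add_single {N : ℕ} (y : Fin N → ℕ) (j : Fin N) :
    ∑ k, (y + Pi.single j 1 : Fin N → ℕ) k = ∑ k, y k + 1 := by
  simp [Finset.sum_add_distrib]

lemma sub_add_single {N : ℕ} (y : Fin N → ℕ) (j : Fin N) (h : y j ≠ 0) :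
    y - Pi.single j 1 + Pi.single j 1 = y := by
  apply tsub_add_cancel_of_le
  intro k
  by_cases e : k = j
  · subst e; simp; omega
  · simp [Pi.single_eq_of_ne e]

lemma Lev.LL {N : ℕ} {k : ℤ} {f : (Fin N → ℕ) → ℚ} (h : Lev k f) : Lev (k + 1) (LL f) := by
  intro y hy
  obtain ⟨j, -, hj⟩ := Finset.exists_ne_zero_of_sum_ne_zero hy
  have h1 := h _ (right_ne_zero_of_mul hj)
  have h2 : y j ≠ 0 := by exact_mod_cast left_ne_zero_of_mul hj
  have h3 := sum_add_single (y - Pi.single j 1) j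
  rw [sub_add_single y j h2] at h3
  omega

lemma Lev.LLi {N : ℕ} {k : ℤ} {f : (Fin N → ℕ) → ℚ} (h : Lev k f) (m : ℕ) :
    Lev (k + m) (_root_.LL^[m] f) := by
  induction m with
  | zero => simpa using h
  | succ m ih =>
    rw [Function.iterate_succ_apply']
    have := ih.LL
    push_cast
    rwa [← add_assoc]

lemma Lev.MM {N : ℕ} {k : ℤ} {f : (Fin N → ℕ) → ℚ} (u : Fin N → ℕ) (h : Lev k f) :
    Lev (k - 1) (MM u f) := by
  intro y hy
  obtain ⟨j, -, hj⟩ := Finset.exists_ne_zero_of_sum_ne_zero hy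
  have h1 := h _ (right_ne_zero_of_mul hj)
  have h3 := sum_add_single y j
  omega

lemma comm_pt {N : ℕ} (u : Fin N → ℕ) (f : (Fin N → ℕ) → ℚ) (y : Fin N → ℕ) :
    MM u (LL f) y = LL (MM u f) y + ((∑ j, (u j : ℚ)) - 2 * ∑ j, (y j : ℚ)) * f y := by
  have key : ∀ j k : Fin N,
      ((u j : ℚ) - y j) * (((y + Pi.single j 1 : Fin N → ℕ) k : ℕ) * f (y + Pi.single j 1 - Pi.single k 1)) =
      (y k : ℚ) * (((u j : ℚ) - ((y - Pi.single k 1 : Fin N → ℕ) j : ℕ)) *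
        f (y - Pi.single k 1 + Pi.single j 1)) + if k = j then ((u j : ℚ) - 2 * y j) * f y else 0 := by
    intro j k
    by_cases e : k = j
    · subst e
      rw [if_pos rfl, add_tsub_cancel_right]
      by_cases h : y k = 0
      · simp [h]
      · rw [sub_add_single y k h]
        simp only [Pi.add_apply, Pi.sub_apply, Pi.single_eq_same]
        rw [Nat.cast_sub (by omega)]
        push_cast
        ring
    · rw [if_neg e]
      have e' : j ≠ k := fun h => e h.symm
      simp only [Pi.add_apply, Pi.sub_apply, Pi.single_eq_of_ne e, Pi.single_eq_of_ne e',
        add_zero, tsub_zero]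
      by_cases h : y k = 0
      · simp [h]
      · have : y + Pi.single j 1 - Pi.single k 1 = y - Pi.single k 1 + Pi.single j 1 := by
          conv_lhs => rw [← sub_add_single y k h]
          rw [add_right_comm, add_tsub_cancel_right]
        rw [this]; ring
  have h1 : MM u (LL f) y = ∑ j, ∑ k, ((u j : ℚ) - y j) *
      (((y + Pi.single j 1 : Fin N → ℕ) k : ℕ) * f (y + Pi.single j 1 - Pi.single k 1)) := by
    simp only [MM, LL, Finset.mul_sum]
  have h2 : LL (MM u f) y = ∑ j, ∑ k, (y k : ℚ) *
      (((u j : ℚ) - ((y - Pi.single k 1 : Fin N → ℕ) j : ℕ)) *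
        f (y - Pi.single k 1 + Pi.single j 1)) := by
    simp only [MM, LL, Finset.mul_sum]
    exact Finset.sum_comm
  rw [h1, h2]
  simp only [key, Finset.sum_add_distrib, Finset.sum_ite_eq', Finset.mem_univ,
    if_true]
  congr 1
  rw [← Finset.sum_mul, Finset.sum_sub_distrib, Finset.mul_sum]

lemma comm_lev {N : ℕ} (u : Fin N → ℕ) (f : (Fin N → ℕ) → ℚ) (k : ℤ) (h : Lev k f) :
    MM u (LL f) = LL (MM u f) + (((∑ j, u j : ℕ) : ℚ) - 2 * k) • f := by
  funext y
  rw [comm_pt]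
  simp only [Pi.add_apply, Pi.smul_apply, smul_eq_mul]
  by_cases hy : f y = 0
  · simp [hy]
  · rw [← h y hy]; push_cast; rfl

lemma comm_iter {N : ℕ} (u : Fin N → ℕ) (f : (Fin N → ℕ) → ℚ) (k : ℤ) (h : Lev k f) (m : ℕ) :
    MM u (LL^[m + 1] f) = LL^[m + 1] (MM u f) +
      (((m : ℚ) + 1) * (((∑ j, u j : ℕ) : ℚ) - 2 * k - m)) • LL^[m] f := by
  induction m with
  | zero => simpa using comm_lev u f k h
  | succ m ih =>
    rw [Function.iterate_succ_apply', comm_lev u _ _ (h.LLi (m + 1)), ih, LL_add, LL_smul,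
      ← Function.iterate_succ_apply' (f := LL), ← Function.iterate_succ_apply' (f := LL),
      add_assoc, ← add_smul]
    congr 2
    push_cast
    ring

lemma lef {N : ℕ} (u : Fin N → ℕ) (i : ℕ) : ∀ (m : ℕ) (f : (Fin N → ℕ) → ℚ),
    Lev ((i : ℤ) - 1) f → m + 2 * i ≤ ∑ j, u j + 2 → Zu u (LL^[m] f) → Zu u f := by
  induction i with
  | zero =>
    intro m f hf _ _ y _
    by_contra hy
    have := hf y hy
    omega
  | succ i ihi =>
    intro m
    induction m with
    | zero => intro f _ _ h; exact h
    | succ m ihm =>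
      intro f hf hm hz
      have hf' : Lev (i : ℤ) f := by simpa using hf
      have hM := hf'.MM u
      have hc := comm_iter u f i hf' m
      set κ : ℚ := ((m : ℚ) + 1) * (((∑ j, u j : ℕ) : ℚ) - 2 * (i : ℤ) - m) with hκ
      have hκ0 : κ ≠ 0 := by
        apply mul_ne_zero
        · positivity
        · have : ((m : ℚ) + 1 + 2 * (i + 1)) ≤ ((∑ j, u j : ℕ) : ℚ) + 2 := by exact_mod_cast hm
          intro h0
          push_cast at h0 this
          linarith
      have h1 : Zu u (LL^[m] (LL (MM u f) + κ • f)) := by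
        rw [LLi_add, LLi_smul, ← Function.iterate_succ_apply (f := LL), ← hc]
        exact hz.MM
      have hlev : Lev ((i + 1 : ℕ) - 1 : ℤ) (LL (MM u f) + κ • f) := by
        intro y hy
        by_cases h0 : f y = 0
        · have h2 : LL (MM u f) y ≠ 0 := by
            simpa [h0] using hy
          have := hM.LL y h2
          push_cast at this ⊢
          linarith
        · exact hf y h0
      have h2 := ihm _ hlev (by omega) h1
      have h3 : Zu u (LL^[m + 2] (MM u f)) := by
        intro y hy
        have e1 := h2.LLi (m + 1) y hy
        rw [LLi_add, LLi_smul, ← Function.iterate_succ_apply (f := LL)] at e1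
        have e2 := hz y hy
        simp only [Pi.add_apply, Pi.smul_apply, e2, smul_zero, add_zero] at e1
        exact e1
      have h4 := ihi (m + 2) _ hM (by omega) h3
      intro y hy
      have e1 := h2 y hy
      have e2 := h4.LL y hy
      simp only [Pi.add_apply, Pi.smul_apply, e2, zero_add, smul_eq_mul] at e1
      exact (mul_eq_zero.mp e1).resolve_left hκ0

/-- Every element of a finite set of monomials is below a maximal one. -/
lemma exists_max {N : ℕ} (Γ : Finset (Fin N → ℕ)) (x : Fin N → ℕ) (hx : x ∈ Γ) :
    ∃ u ∈ Γ, x ≤ u ∧ ∀ ν ∈ Γ, u ≤ ν → u = ν := by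
  obtain ⟨u, hxu, hu⟩ := Γ.exists_le_maximal hx
  exact ⟨u, hu.prop, hxu, fun ν hν h => le_antisymm h (hu.le_of_ge hν h)⟩

/-- The theorem of Hibi on pure O-sequences. -/
lemma hibi {N : ℕ} (Γ : Finset (Fin N → ℕ)) (d : ℕ)
    (hid : ∀ μ ∈ Γ, ∀ ν : Fin N → ℕ, ν ≤ μ → ν ∈ Γ)
    (hmax : ∀ μ ∈ Γ, (∀ ν ∈ Γ, μ ≤ ν → μ = ν) → ∑ j, μ j = d) (i : ℕ) (hi : 2 * i ≤ d) :
    (Γ.filter fun μ => ∑ j, μ j = i).card ≤ (Γ.filter fun μ => ∑ j, μ j = d - i).card := by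
  classical
  set S := Γ.filter fun μ => ∑ j, μ j = i with hS
  set T := Γ.filter fun μ => ∑ j, μ j = d - i with hT
  let ext : (S → ℚ) → ((Fin N → ℕ) → ℚ) := fun g y => if h : y ∈ S then g ⟨y, h⟩ else 0
  let φ : (S → ℚ) →ₗ[ℚ] (T → ℚ) :=
    { toFun := fun g y => (LL^[d - 2 * i] (ext g)) y
      map_add' := by
        intro g g'
        have : ext (g + g') = ext g + ext g' := by
          funext y
          by_cases h : y ∈ S <;> simp [ext, h]
        funext y
        simp only [this, LLi_add, Pi.add_apply]
      map_smul' := by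
        intro r g
        have : ext (r • g) = r • ext g := by
          funext y
          by_cases h : y ∈ S <;> simp [ext, h]
        funext y
        simp only [this, LLi_smul, Pi.smul_apply, RingHom.id_apply] }
  have hinj : Function.Injective φ := by
    rw [← LinearMap.ker_eq_bot, LinearMap.ker_eq_bot']
    intro g hg
    have hlev : Lev (i : ℤ) (ext g) := by
      intro y hy
      by_cases h : y ∈ S
      · have := (Finset.mem_filter.mp h).2
        exact_mod_cast this
      · simp [ext, h] at hy
    funext x
    obtain ⟨u, hu, hxu, humax⟩ := exists_max Γ x.1 (Finset.mem_filter.mp x.2).1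
    have hud := hmax u hu humax
    have hz : Zu u (LL^[d - 2 * i] (ext g)) := by
      intro y hy
      by_contra h0
      have h1 := hlev.LLi _ y h0
      have hyT : y ∈ T := by
        rw [hT, Finset.mem_filter]
        exact ⟨hid u hu y hy, by omega⟩
      exact h0 (congrFun hg ⟨y, hyT⟩)
    have h2 := lef u (i + 1) (d - 2 * i) (ext g) (by simpa using hlev) (by omega) hz x.1 hxu
    simpa [ext] using h2
  have := LinearMap.finrank_le_finrank_of_injective hinj
  simpa using this

lemma pure_flawless (q : Polynomial ℤ) (h : IsPureOSequence fun i => q.coeff i) (i : ℕ)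
    (hi : 2 * i ≤ q.natDegree) : q.coeff i ≤ q.coeff (q.natDegree - i) := by
  obtain ⟨N, Γ, ⟨x, hx⟩, hid, ⟨d, hmax⟩, hc⟩ := h
  replace hc : ∀ i : ℕ, ((Γ.filter fun μ => ∑ j, μ j = i).card : ℤ) = q.coeff i := hc
  have hd : q.natDegree = d := by
    obtain ⟨u, hu, -, hm⟩ := exists_max Γ x hx
    have hud := hmax u hu hm
    have hne : q.coeff d ≠ 0 := by
      rw [← hc d]
      have : (Γ.filter fun μ => ∑ j, μ j = d).Nonempty := ⟨u, by simp [hu, hud]⟩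
      exact_mod_cast this.card_pos.ne'
    apply le_antisymm _ (Polynomial.le_natDegree_of_ne_zero hne)
    have hq : q.coeff q.natDegree ≠ 0 := by
      rw [Polynomial.coeff_natDegree, Polynomial.leadingCoeff_ne_zero]
      rintro rfl
      simp at hne
    rw [← hc] at hq
    have h1 : (Γ.filter fun μ => ∑ j, μ j = q.natDegree).card ≠ 0 := by exact_mod_cast hq
    obtain ⟨y, hy⟩ := Finset.card_ne_zero.mp h1
    rw [Finset.mem_filter] at hy
    obtain ⟨v, hv, hyv, hm'⟩ := exists_max Γ y hy.1
    rw [← hy.2, ← hmax v hv hm']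
    exact Finset.sum_le_sum fun j _ => hyv j
  rw [hd] at hi ⊢
  rw [← hc, ← hc]
  exact_mod_cast hibi Γ d hid hmax i hi

/-- Let `A ∈ ℤ^{(t+2)×(t+c+3)}` be a degree matrix (codimension `c+2 ≥ 2`) with
`a_{2,1} < 0`, and let `h^A = (h_0,…,h_s)`. Then there exists an index `i_0` (which can be
taken with `a_{1,1} ≤ i_0 ≤ a_{1,1} - a_{2,1} - 1`) such that `h_{i_0} > h_{s-i_0}`; in
particular `h^A` is not flawless (some `i_0 ≤ s/2` satisfies `h_{i_0} > h_{s-i_0}`), hence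
not a pure O-sequence. -/
theorem not_flawless_of_neg_a21 (t c : ℕ)
    (A : Matrix (Fin (t + 2)) (Fin (t + c + 3)) ℤ)
    (hA : IsDegreeMatrix A) (h21 : A 1 0 < 0) :
    (∃ i0 : ℕ, A 0 0 ≤ (i0 : ℤ) ∧ (i0 : ℤ) ≤ A 0 0 - A 1 0 - 1 ∧
        (hp (t + 2) (t + c + 3) A).coeff ((hp (t + 2) (t + c + 3) A).natDegree - i0) <
          (hp (t + 2) (t + c + 3) A).coeff i0) ∧
      (∃ i0 : ℕ, 2 * i0 ≤ (hp (t + 2) (t + c + 3) A).natDegree ∧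
        (hp (t + 2) (t + c + 3) A).coeff ((hp (t + 2) (t + c + 3) A).natDegree - i0) <
          (hp (t + 2) (t + c + 3) A).coeff i0) ∧
      ¬ IsPureOSequence fun i => (hp (t + 2) (t + c + 3) A).coeff i := by
  obtain ⟨⟨α, β, hαβ⟩, hrow, hcol, hdiag⟩ := hA
  let a : ℕ → ℤ := fun k => α ⟨min k (t + 1), by omega⟩
  let b : ℕ → ℤ := fun k => β ⟨min k (t + c + 2), by omega⟩
  have hae : ∀ i : Fin (t + 2), a i = α i := by
    intro i
    simp only [a]
    congr 1
    apply Fin.ext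
    have := i.2
    simp only
    omega
  have hbe : ∀ j : Fin (t + c + 3), b j = β j := by
    intro j
    simp only [b]
    congr 1
    apply Fin.ext
    have := j.2
    simp only
    omega
  have hAe : A = fun (i : Fin (t + 2)) (j : Fin (t + c + 3)) => b j - a i := by
    funext i j
    rw [hαβ, hae, hbe]
  have ha : Monotone a := by
    intro k l hkl
    have := hcol ⟨min k (t + 1), by omega⟩ ⟨min l (t + 1), by omega⟩ 0
      (by rw [Fin.mk_le_mk]; omega)
    rw [hαβ, hαβ] at this
    simp only [a]
    linarith
  have hb : Monotone b := by
    intro k l hkl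
    have := hrow 0 ⟨min k (t + c + 2), by omega⟩ ⟨min l (t + c + 2), by omega⟩
      (by rw [Fin.mk_le_mk]; omega)
    rw [hαβ, hαβ] at this
    simp only [b]
    linarith
  have hab : ∀ i, a i < b i := by
    intro i
    have h1 := hdiag ⟨min i (t + 1), by omega⟩ (by simp only; omega)
    rw [hαβ] at h1
    have h2 : b (min i (t + 1)) ≤ b i := hb (by omega)
    have h3 := hbe ⟨min i (t + 1), by omega⟩
    simp only at h3
    rw [h3] at h2
    simp only [a]
    linarith
  have h00 : A 0 0 = b 0 - a 0 := by rw [hAe]; rfl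
  have h10 : A 1 0 = b 0 - a 1 := by rw [hAe]; rfl
  have hH : hp (t + 2) (t + c + 3) A = HH a b (t + 2) (t + c + 3) := by rw [hAe]; rfl
  have h0 := hab 0
  obtain ⟨m1, m2⟩ := main_poly a b ha hb hab (by omega) t c
  rw [hH]
  refine ⟨⟨(b 0 - a 0).toNat, by omega, by omega, m2⟩, ⟨(b 0 - a 0).toNat, m1, m2⟩, ?_⟩
  intro hpure
  exact absurd (pure_flawless _ hpure _ m1) (not_le.mpr m2)
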